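/- arXiv:1807.08773 — 2 statements merged into one kernel-verified Lean document; each statement's English description precedes it below -/
import Mathlib

section
/- Let ρ and ρ' be density matrices of the same finite dimension with different spectra, and suppose S(ρ') > S(ρ) and rank(ρ') ≥ rank(ρ). Then there exists a finite-dimensional density matrix σ, a finite dimension d, and a unitary U on the joint space of the system, a d-dimensional ancilla, and the catalyst, such that tr_C[U(ρ ⊗ 𝟙_d ⊗ σ)U†] = ρ' ⊗ 𝟙_d and tr_{A,R}[U(ρ ⊗ 𝟙_d ⊗ σ)U†] = σ, where 𝟙_d denotes the maximally mixed state (1/d of the identity) in dimension d, tr_C traces out the catalyst factor, and tr_{A,R} traces out the system and ancilla factors. -/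
open scoped Kronecker ComplexOrder
open Matrix

noncomputable section

/-- `ρ` is a density matrix: positive semidefinite with unit trace. -/
def IsDensityMatrix {ι : Type*} [Fintype ι] (ρ : Matrix ι ι ℂ) : Prop :=
  ρ.PosSemidef ∧ ρ.trace = 1

/-- Partial trace over the second tensor factor. -/
def ptrace2 {ι κ : Type*} [Fintype κ] (M : Matrix (ι × κ) (ι × κ) ℂ) : Matrix ι ι ℂ :=
  Matrix.of fun i j => ∑ k, M (i, k) (j, k)

/-- Partial trace over the first tensor factor. -/
def ptrace1 {ι κ : Type*} [Fintype ι] (M : Matrix (ι × κ) (ι × κ) ℂ) : Matrix κ κ ℂ :=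
  Matrix.of fun i j => ∑ k, M (k, i) (k, j)

/-- Dephasing (decoherence) channel in the fixed (standard) orthonormal basis `{|j⟩}`:
`D[σ] = ∑ j ⟨j|σ|j⟩ |j⟩⟨j|`. -/
def deph {ι : Type*} [DecidableEq ι] (M : Matrix ι ι ℂ) : Matrix ι ι ℂ :=
  Matrix.diagonal fun j => M j j

/-- The eigenvalue list of a matrix (junk value `0` if not Hermitian). -/
def eigs {ι : Type*} [Fintype ι] [DecidableEq ι] (ρ : Matrix ι ι ℂ) : ι → ℝ :=
  if h : ρ.IsHermitian then h.eigenvalues else 0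

/-- The spectrum of a matrix, as a multiset of real eigenvalues (with multiplicity). -/
def spectra {ι : Type*} [Fintype ι] [DecidableEq ι] (ρ : Matrix ι ι ℂ) : Multiset ℝ :=
  Finset.univ.val.map (eigs ρ)

/-- von Neumann entropy `S(ρ) = -tr(ρ log ρ)`, i.e. the Shannon entropy
of the eigenvalue list (natural logarithm). -/
def vN {ι : Type*} [Fintype ι] [DecidableEq ι] (ρ : Matrix ι ι ℂ) : ℝ :=
  ∑ i, Real.negMulLog (eigs ρ i)

/-- Maximally mixed state `𝟙_d = (1/d)·I_d`. -/
def mm (d : ℕ) : Matrix (Fin d) (Fin d) ℂ :=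
  (d : ℂ)⁻¹ • (1 : Matrix (Fin d) (Fin d) ℂ)

open Filter Topology

theorem exists_perm_mapsTo_of_card_le {α : Type*} [Finite α] {A B : Finset α}
    (h : A.card ≤ B.card) : ∃ e : Equiv.Perm α, ∀ a ∈ A, e a ∈ B := by
  obtain ⟨f⟩ : Nonempty (A ↪ B) := Function.Embedding.nonempty_of_card_le (by simpa using h)
  obtain ⟨e, he⟩ := Equiv.Perm.exists_extending_pair (fun a : A ↦ (a : α)) (fun a : A ↦ (f a : α))
    Subtype.val_injective (Subtype.val_injective.comp f.injective)
  exact ⟨e, fun a ha ↦ he ⟨a, ha⟩ ▸ (f ⟨a, ha⟩).2⟩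

section IIDSequences

variable {X : Type*} [Fintype X] {q : X → ℝ}

theorem sum_pi_prod_eq_one (hq : ∑ x, q x = 1) (N : ℕ) :
    ∑ x : Fin N → X, ∏ i, q (x i) = 1 := by
  rw [← Fintype.sum_pow, hq, one_pow]

theorem exists_exponentialMoment_lt_one (hq : ∀ x, 0 ≤ q x) (hq1 : ∑ x, q x = 1) (g : X → ℝ)
    {a : ℝ} (ha : ∑ x, q x * g x < a) :
    ∃ t : ℝ, 0 < t ∧ ∑ x, q x * Real.exp (t * (g x - a)) < 1 := by
  obtain ⟨K, hK0, hK⟩ : ∃ K : ℝ, 0 < K ∧ ∀ x, |g x - a| ≤ K := by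
    refine ⟨∑ x, |g x - a| + 1, by positivity, fun x ↦ ?_⟩
    have := Finset.single_le_sum (f := fun x ↦ |g x - a|) (fun _ _ ↦ abs_nonneg _)
      (Finset.mem_univ x)
    linarith
  set δ := a - ∑ x, q x * g x with hδ
  have hδ0 : 0 < δ := by linarith
  have hmean : ∑ x, q x * (g x - a) = -δ := by
    simp only [mul_sub, Finset.sum_sub_distrib, ← Finset.sum_mul, hq1, hδ]
    ring
  refine ⟨min (1 / K) (δ / (2 * K ^ 2)), by positivity, ?_⟩
  set t := min (1 / K) (δ / (2 * K ^ 2)) with ht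
  have ht0 : 0 < t := by positivity
  have ht1 : t * K ≤ 1 := by
    have := min_le_left (1 / K) (δ / (2 * K ^ 2))
    rwa [← ht, le_div_iff₀ hK0] at this
  have ht2 : t * (2 * K ^ 2) ≤ δ := by
    have := min_le_right (1 / K) (δ / (2 * K ^ 2))
    rwa [← ht, le_div_iff₀ (by positivity)] at this
  have hexp (x : X) : Real.exp (t * (g x - a)) ≤ 1 + t * (g x - a) + (t * K) ^ 2 := by
    have h1 : |t * (g x - a)| ≤ t * K := by
      rw [abs_mul, abs_of_pos ht0]
      exact mul_le_mul_of_nonneg_left (hK x) ht0.le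
    have h2 := (abs_le.1 (Real.abs_exp_sub_one_sub_id_le (h1.trans ht1))).2
    have h3 : (t * (g x - a)) ^ 2 ≤ (t * K) ^ 2 := sq_le_sq' (abs_le.1 h1).1 (abs_le.1 h1).2
    linarith
  calc ∑ x, q x * Real.exp (t * (g x - a))
      ≤ ∑ x, q x * (1 + t * (g x - a) + (t * K) ^ 2) :=
        Finset.sum_le_sum fun x _ ↦ mul_le_mul_of_nonneg_left (hexp x) (hq x)
    _ = (∑ x, q x) * (1 + (t * K) ^ 2) + t * ∑ x, q x * (g x - a) := by
        rw [Finset.sum_mul, Finset.mul_sum, ← Finset.sum_add_distrib]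
        exact Finset.sum_congr rfl fun x _ ↦ by ring
    _ < 1 := by
        rw [hq1, hmean]
        nlinarith [mul_pos ht0 hδ0]

theorem tendsto_sum_upper_tail (hq : ∀ x, 0 ≤ q x) (hq1 : ∑ x, q x = 1) (g : X → ℝ)
    {a : ℝ} (ha : ∑ x, q x * g x < a) :
    Tendsto (fun N : ℕ ↦ ∑ x : Fin N → X with N * a ≤ ∑ i, g (x i), ∏ i, q (x i))
      atTop (𝓝 0) := by
  obtain ⟨t, ht0, ht⟩ := exists_exponentialMoment_lt_one hq hq1 g ha
  have hθ0 : 0 ≤ ∑ x, q x * Real.exp (t * (g x - a)) :=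
    Finset.sum_nonneg fun x _ ↦ mul_nonneg (hq x) (Real.exp_nonneg _)
  refine squeeze_zero (fun N ↦ Finset.sum_nonneg fun x _ ↦ Finset.prod_nonneg fun i _ ↦ hq _)
    (fun N ↦ ?_) (tendsto_pow_atTop_nhds_zero_of_lt_one hθ0 ht)
  rw [Fintype.sum_pow, Finset.sum_filter]
  refine Finset.sum_le_sum fun x _ ↦ ?_
  have hx : 0 ≤ ∏ i, q (x i) := Finset.prod_nonneg fun i _ ↦ hq _
  rw [Finset.prod_mul_distrib, ← Real.exp_sum]
  split_ifs with h
  · refine le_mul_of_one_le_right hx (Real.one_le_exp ?_)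
    rw [← Finset.mul_sum, Finset.sum_sub_distrib]
    simp only [Finset.sum_const, Finset.card_univ, Fintype.card_fin, nsmul_eq_mul]
    exact mul_nonneg ht0.le (by linarith)
  · positivity

theorem prod_eq_exp_sum_log {X : Type*} {q : X → ℝ} {N : ℕ} {x : Fin N → X} (hq : ∀ x, 0 ≤ q x)
    (hx : ∏ i, q (x i) ≠ 0) : ∏ i, q (x i) = Real.exp (∑ i, Real.log (q (x i))) := by
  rw [Real.exp_sum]
  refine Finset.prod_congr rfl fun i _ ↦ (Real.exp_log ?_).symm
  exact (hq _).lt_of_ne' (Finset.prod_ne_zero_iff.1 hx i (Finset.mem_univ i))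

theorem exists_smallSet_of_entropy_lt [DecidableEq X] (hq : ∀ x, 0 ≤ q x) (hq1 : ∑ x, q x = 1)
    {a : ℝ} (ha : ∑ x, Real.negMulLog (q x) < a) {η : ℝ} (hη : 0 < η) :
    ∀ᶠ N : ℕ in atTop, ∃ A : Finset (Fin N → X),
      A.card ≤ Real.exp (N * a) ∧ ∑ x with x ∉ A, ∏ i, q (x i) < η := by
  have ha' : ∑ x, q x * -Real.log (q x) < a := by
    simpa [Real.negMulLog] using ha
  filter_upwards [(tendsto_sum_upper_tail hq hq1 _ ha').eventually (gt_mem_nhds hη)] with N hN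
  refine ⟨Finset.univ.filter fun x : Fin N → X ↦
    ∏ i, q (x i) ≠ 0 ∧ ∑ i, -Real.log (q (x i)) < N * a, ?_, ?_⟩
  · rw [← mul_le_mul_iff_of_pos_right (Real.exp_pos (-(N * a))), ← Real.exp_add, add_neg_cancel,
      Real.exp_zero, ← nsmul_eq_mul, ← Finset.sum_const, ← sum_pi_prod_eq_one hq1 N]
    refine (Finset.sum_le_sum fun x hx ↦ ?_).trans (Finset.sum_le_univ_sum_of_nonneg
      fun x ↦ Finset.prod_nonneg fun i _ ↦ hq (x i))
    rw [Finset.mem_filter] at hx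
    rw [prod_eq_exp_sum_log hq hx.2.1]
    have := hx.2.2
    rw [Finset.sum_neg_distrib] at this
    exact Real.exp_le_exp.2 (by linarith)
  · refine lt_of_le_of_lt ?_ hN
    rw [Finset.sum_filter, Finset.sum_filter]
    refine Finset.sum_le_sum fun x _ ↦ ?_
    have hx : 0 ≤ ∏ i, q (x i) := Finset.prod_nonneg fun i _ ↦ hq _
    simp only [Finset.mem_filter, Finset.mem_univ, true_and, not_and, not_lt]
    split_ifs with h1 h2 h2
    · rfl
    · exact le_of_eq (by_contra fun h ↦ h2 (h1 h))
    · exact hx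
    · rfl

theorem exists_largeSet_of_lt_entropy (hq : ∀ x, 0 ≤ q x) (hq1 : ∑ x, q x = 1) {b : ℝ}
    (hb : b < ∑ x, Real.negMulLog (q x)) (f : X → ℝ) {v : ℝ} (hv : v < ∑ x, q x * f x) :
    ∀ᶠ N : ℕ in atTop, ∃ B : Finset (Fin N → X),
      Real.exp (N * b) ≤ 2 * B.card ∧ ∀ x ∈ B, N * v < ∑ i, f (x i) := by
  have hb' : ∑ x, q x * Real.log (q x) < -b := by
    simp only [Real.negMulLog, neg_mul, Finset.sum_neg_distrib] at hb
    linarith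
  have hv' : ∑ x, q x * -f x < -v := by
    simpa using hv
  have h4 : (0 : ℝ) < 1 / 4 := by norm_num
  filter_upwards [(tendsto_sum_upper_tail hq hq1 _ hb').eventually (gt_mem_nhds h4),
    (tendsto_sum_upper_tail hq hq1 _ hv').eventually (gt_mem_nhds h4)] with N hN₁ hN₂
  set B : Finset (Fin N → X) :=
    {x | N * v < ∑ i, f (x i) ∧ ∏ i, q (x i) ≤ Real.exp (-(N * b))} with hB
  refine ⟨B, ?_, fun x hx ↦ (Finset.mem_filter.1 hx).2.1⟩
  have hle : ∑ x ∈ B, ∏ i, q (x i) ≤ B.card * Real.exp (-(N * b)) := by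
    rw [← nsmul_eq_mul, ← Finset.sum_const]
    exact Finset.sum_le_sum fun x hx ↦ (Finset.mem_filter.1 hx).2.2
  have hcompl : (1 : ℝ) ≤ ∑ x ∈ B, ∏ i, q (x i) + 1 / 4 + 1 / 4 := by
    refine (sum_pi_prod_eq_one hq1 N).symm.le.trans (le_trans ?_
      (add_le_add (add_le_add_right hN₁.le _) hN₂.le))
    rw [hB, Finset.sum_filter, Finset.sum_filter, Finset.sum_filter, ← Finset.sum_add_distrib,
      ← Finset.sum_add_distrib]
    refine Finset.sum_le_sum fun x _ ↦ ?_
    have hx : 0 ≤ ∏ i, q (x i) := Finset.prod_nonneg fun i _ ↦ hq _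
    by_cases h1 : N * v < ∑ i, f (x i)
    · by_cases h2 : ∏ i, q (x i) ≤ Real.exp (-(N * b))
      · rw [if_pos ⟨h1, h2⟩]
        split_ifs <;> linarith
      · have h3 : N * -b ≤ ∑ i, Real.log (q (x i)) := by
          push Not at h2
          rw [prod_eq_exp_sum_log hq ((Real.exp_pos _).trans h2).ne', Real.exp_lt_exp] at h2
          linarith
        rw [if_pos h3]
        split_ifs <;> linarith
    · have h3 : N * -v ≤ ∑ i, -f (x i) := by
        rw [Finset.sum_neg_distrib]
        linarith
      rw [if_pos h3]
      split_ifs <;> linarith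
  have h : 1 ≤ 2 * B.card * Real.exp (-(N * b)) := by linarith
  rwa [Real.exp_neg, ← div_eq_mul_inv, one_le_div (Real.exp_pos _)] at h

theorem exists_perm_lt_sum {p : X → ℝ} (hp : ∀ x, 0 ≤ p x) (hp1 : ∑ x, p x = 1)
    (hq : ∀ x, 0 ≤ q x) (hq1 : ∑ x, q x = 1)
    (hS : ∑ x, Real.negMulLog (p x) < ∑ x, Real.negMulLog (q x))
    (f : X → ℝ) {u : ℝ} (hu : u < ∑ x, q x * f x) :
    ∃ N : ℕ, 0 < N ∧ ∃ π : Equiv.Perm (Fin N → X),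
      N * u < ∑ x : Fin N → X, (∏ i, p (x i)) * ∑ i, f (π x i) := by
  classical
  obtain ⟨v, huv, hv⟩ := exists_between hu
  obtain ⟨a, hpa, ha⟩ := exists_between hS
  obtain ⟨b, hab, hb⟩ := exists_between ha
  obtain ⟨L, hvL, hL⟩ : ∃ L : ℝ, |v| ≤ L ∧ ∀ x, |f x| ≤ L := by
    refine ⟨|v| + ∑ x, |f x|, le_add_of_nonneg_right (by positivity), fun x ↦ ?_⟩
    have := Finset.single_le_sum (f := fun x ↦ |f x|) (fun _ _ ↦ abs_nonneg _) (Finset.mem_univ x)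
    linarith [abs_nonneg v]
  have hL0 : 0 ≤ L := (abs_nonneg v).trans hvL
  have hgap : ∀ᶠ N : ℕ in atTop, 2 * Real.exp (N * a) ≤ Real.exp (N * b) := by
    have h : Tendsto (fun N : ℕ ↦ (N : ℝ) * (b - a)) atTop atTop :=
      tendsto_natCast_atTop_atTop.atTop_mul_const (by linarith)
    filter_upwards [h.eventually_ge_atTop (Real.log 2)] with N hN
    calc 2 * Real.exp (N * a) = Real.exp (Real.log 2 + N * a) := by
          rw [Real.exp_add, Real.exp_log two_pos]
      _ ≤ Real.exp (N * b) := Real.exp_le_exp.2 (by linarith)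
  have hη : 0 < (v - u) / (2 * L + 1) := div_pos (by linarith) (by linarith)
  obtain ⟨N, ⟨A, hA, hAη⟩, ⟨B, hB, hBf⟩, hN, hN0⟩ :=
    ((exists_smallSet_of_entropy_lt hp hp1 hpa hη).and
      ((exists_largeSet_of_lt_entropy hq hq1 hb f hv).and
        (hgap.and (eventually_gt_atTop 0)))).exists
  have hcard : A.card ≤ B.card := by
    have : (A.card : ℝ) ≤ B.card := by linarith
    exact_mod_cast this
  obtain ⟨π, hπ⟩ := exists_perm_mapsTo_of_card_le hcard
  refine ⟨N, hN0, π, ?_⟩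
  have hN0' : (0 : ℝ) < N := by exact_mod_cast hN0
  have hpoint (x : Fin N → X) : (∏ i, p (x i)) * (N * v)
      - (if x ∉ A then ∏ i, p (x i) else 0) * (N * (2 * L))
      ≤ (∏ i, p (x i)) * ∑ i, f (π x i) := by
    have hx : 0 ≤ ∏ i, p (x i) := Finset.prod_nonneg fun i _ ↦ hp _
    by_cases h : x ∉ A
    · rw [if_pos h]
      have h1 : -(N * L) ≤ ∑ i, f (π x i) := by
        have : ∑ _i : Fin N, -L ≤ ∑ i, f (π x i) :=
          Finset.sum_le_sum fun i _ ↦ (abs_le.1 (hL _)).1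
        simpa using this
      have h2 : (N : ℝ) * v ≤ N * L :=
        mul_le_mul_of_nonneg_left ((le_abs_self v).trans hvL) hN0'.le
      rw [← mul_sub]
      exact mul_le_mul_of_nonneg_left (by linarith) hx
    · rw [if_neg h, zero_mul, sub_zero]
      exact mul_le_mul_of_nonneg_left (hBf _ (hπ x (not_not.1 h))).le hx
  refine lt_of_lt_of_le ?_ (Finset.sum_le_sum fun x _ ↦ hpoint x)
  rw [Finset.sum_sub_distrib, ← Finset.sum_mul, ← Finset.sum_mul, ← Finset.sum_filter,
    sum_pi_prod_eq_one hp1]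
  rw [lt_div_iff₀ (by linarith)] at hAη
  have h0 : 0 ≤ ∑ x with x ∉ A, ∏ i, p (x i) :=
    Finset.sum_nonneg fun x _ ↦ Finset.prod_nonneg fun i _ ↦ hp _
  nlinarith [mul_lt_mul_of_pos_left hAη hN0', mul_nonneg hN0'.le h0]

end IIDSequences

/-- The distribution `p` can be turned into `q` by a permutation acting jointly on the system and an
independent catalyst `c`, whose marginal is returned unchanged (possibly correlated with the
system). -/
def CatalyticallyReaches {X : Type} [Fintype X] (p q : X → ℝ) : Prop :=
  ∃ (C : Type) (_ : Fintype C) (c : C → ℝ), (∀ y, 0 ≤ c y) ∧ ∑ y, c y = 1 ∧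
    ∃ π : Equiv.Perm (X × C),
      (∀ g : X → ℝ, ∑ z, p z.1 * c z.2 * g (π z).1 = ∑ x, q x * g x) ∧
      ∀ h : C → ℝ, ∑ z, p z.1 * c z.2 * h (π z).2 = ∑ y, c y * h y

section CatalyticallyReaches

variable {X : Type} [Fintype X] {p q : X → ℝ}

theorem CatalyticallyReaches.sum_eq (h : CatalyticallyReaches p q) : ∑ x, q x = ∑ x, p x := by
  obtain ⟨C, _, c, -, hc, π, hg, -⟩ := h
  have := hg fun _ ↦ 1
  simp only [mul_one] at this
  rw [← this, Fintype.sum_prod_type]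
  simp [← Finset.mul_sum, hc]

theorem CatalyticallyReaches.of_comp_equiv (e : Equiv.Perm X)
    (h : CatalyticallyReaches (p ∘ e) q) : CatalyticallyReaches p q := by
  obtain ⟨C, _, c, hc0, hc, π, hg, hh⟩ := h
  refine ⟨C, ‹_›, c, hc0, hc, (Equiv.prodCongr e (Equiv.refl C)).symm.trans π, fun g ↦ ?_,
    fun h ↦ ?_⟩
  · rw [← hg, ← Equiv.sum_comp (Equiv.prodCongr e (Equiv.refl C))]
    simp [Prod.map]
  · rw [← hh, ← Equiv.sum_comp (Equiv.prodCongr e (Equiv.refl C))]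
    simp [Prod.map]

theorem CatalyticallyReaches.of_comp_embedding {Y : Type} [Fintype Y] (ι : Y ↪ X)
    (hp : ∀ x ∉ Set.range ι, p x = 0) (hq : ∀ x ∉ Set.range ι, q x = 0)
    (h : CatalyticallyReaches (p ∘ ι) (q ∘ ι)) : CatalyticallyReaches p q := by
  classical
  obtain ⟨C, _, c, hc0, hc, π, hg, hh⟩ := h
  set j : Y × C ↪ X × C := ι.prodMap (Function.Embedding.refl C) with hj
  have hsum (F : X × C → ℝ) :
      ∑ z, p z.1 * c z.2 * F (π.viaFintypeEmbedding j z)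
        = ∑ w : Y × C, p (ι w.1) * c w.2 * F (j (π w)) := by
    refine (Fintype.sum_of_injective j j.injective _ _ (fun z hz ↦ ?_) fun w ↦ ?_).symm
    · rw [hp, zero_mul, zero_mul]
      rintro ⟨y, hy⟩
      exact hz ⟨(y, z.2), by simp [hj, hy]⟩
    · rw [Equiv.Perm.viaFintypeEmbedding_apply_image]
      simp [hj]
  refine ⟨C, ‹_›, c, hc0, hc, π.viaFintypeEmbedding j, fun g ↦ ?_, fun h ↦ ?_⟩
  · rw [hsum fun z ↦ g z.1]
    refine (hg (g ∘ ι)).trans ?_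
    exact Fintype.sum_of_injective ι ι.injective _ _ (fun x hx ↦ by rw [hq x hx, zero_mul])
      fun y ↦ rfl
  · rw [hsum fun z ↦ h z.2]
    exact hh h

theorem convex_setOf_catalyticallyReaches (p : X → ℝ) :
    Convex ℝ {q | CatalyticallyReaches p q} := by
  rintro q ⟨C, _, c, hc0, hc, π, hg, hh⟩ r ⟨D, _, d, hd0, hd, τ, hg', hh'⟩ s t hs ht hst
  refine ⟨C ⊕ D, inferInstance, Sum.elim (fun y ↦ s * c y) fun y ↦ t * d y, ?_, ?_,
    (Equiv.prodSumDistrib X C D).trans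
      ((Equiv.sumCongr π τ).trans (Equiv.prodSumDistrib X C D).symm), fun g ↦ ?_, fun h ↦ ?_⟩
  · rintro (y | y)
    · exact mul_nonneg hs (hc0 y)
    · exact mul_nonneg ht (hd0 y)
  · simp [← Finset.mul_sum, hc, hd, hst]
  · rw [← Equiv.sum_comp (Equiv.prodSumDistrib X C D).symm, Fintype.sum_sum_type]
    simp only [Pi.add_apply, Pi.smul_apply, smul_eq_mul, add_mul, Finset.sum_add_distrib, mul_assoc,
      ← Finset.mul_sum, ← hg, ← hg']
    simp [Finset.mul_sum, mul_left_comm, mul_assoc]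
  · rw [← Equiv.sum_comp (Equiv.prodSumDistrib X C D).symm, Fintype.sum_sum_type,
      Fintype.sum_sum_type]
    simp only [Sum.elim_inl, Sum.elim_inr, mul_assoc, ← Finset.mul_sum, ← hh fun y ↦ h (.inl y),
      ← hh' fun y ↦ h (.inr y)]
    simp [Finset.mul_sum, mul_left_comm, mul_assoc]

theorem sum_resample {N : ℕ} (p : X → ℝ) (j : Fin N) (G : (Fin N → X) → ℝ) (hp : ∑ x, p x = 1) :
    ∑ s, ∑ z : Fin N → X, p s * ((∏ i, p (z i)) * G (Function.update z j s))
      = ∑ z : Fin N → X, (∏ i, p (z i)) * G z := by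
  have hinv : Function.Involutive
      fun w : X × (Fin N → X) ↦ (w.2 j, Function.update w.2 j w.1) := fun w ↦ by simp
  have hswap : ∑ w : X × (Fin N → X), p w.1 * ((∏ i, p (w.2 i)) * G (Function.update w.2 j w.1))
      = ∑ w : X × (Fin N → X), p w.1 * ((∏ i, p (w.2 i)) * G w.2) := by
    rw [← Equiv.sum_comp hinv.toPerm]
    refine Finset.sum_congr rfl fun w _ ↦ ?_
    simp only [Function.Involutive.coe_toPerm, Function.update_idem, Function.update_eq_self,
      ← mul_assoc]
    congr 1
    rw [← Finset.mul_prod_erase _ _ (Finset.mem_univ j),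
      ← Finset.mul_prod_erase _ (fun i ↦ p (w.2 i)) (Finset.mem_univ j), Function.update_self,
      mul_left_comm]
    congr 2
    exact Finset.prod_congr rfl fun i hi ↦ by rw [Function.update_of_ne (Finset.ne_of_mem_erase hi)]
  rw [← Fintype.sum_prod_type', hswap, Fintype.sum_prod_type]
  simp only [← Finset.mul_sum, ← Finset.sum_mul, hp, one_mul]

end CatalyticallyReaches

theorem sum_fiberwise_mul {α β : Type*} [Fintype α] [Fintype β] [DecidableEq β] (φ : α → β)
    (μ : α → ℝ) (g : β → ℝ) : ∑ b, (∑ a with φ a = b, μ a) * g b = ∑ a, μ a * g (φ a) := by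
  rw [← Finset.sum_fiberwise Finset.univ φ]
  refine Finset.sum_congr rfl fun b _ ↦ ?_
  rw [Finset.sum_mul]
  exact Finset.sum_congr rfl fun a ha ↦ by rw [(Finset.mem_filter.1 ha).2]

section Averaging

variable {X : Type} [Fintype X] {p : X → ℝ} {M : ℕ}

/-- Apply `π` to the register when the counter is `0`, and decrement the counter cyclically. -/
def stepEquiv (π : Equiv.Perm (Fin (M + 1) → X)) :
    Equiv.Perm (Fin (M + 1) × (Fin (M + 1) → X)) where
  toFun w := (w.1 - 1, if w.1 = 0 then π w.2 else w.2)
  invFun w := (w.1 + 1, if w.1 + 1 = 0 then π.symm w.2 else w.2)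
  left_inv w := by
    rcases w with ⟨j, y⟩
    by_cases hj : j = 0 <;> simp [hj]
  right_inv w := by
    rcases w with ⟨j, y⟩
    by_cases hj : j + 1 = 0
    · simp [eq_neg_of_add_eq_zero_left hj]
    · simp [hj]

/-- Exchange the system with the site of the register selected by the counter. -/
def exchangeEquiv (X : Type) (N : ℕ) : Equiv.Perm (X × (Fin N × (Fin N → X))) where
  toFun w := (w.2.2 w.2.1, (w.2.1, Function.update w.2.2 w.2.1 w.1))
  invFun w := (w.2.2 w.2.1, (w.2.1, Function.update w.2.2 w.2.1 w.1))
  left_inv w := by simp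
  right_inv w := by simp

theorem exchangeEquiv_apply {X : Type} {N : ℕ} (s : X) (y : Fin N × (Fin N → X)) :
    exchangeEquiv X N (s, y) = (y.2 y.1, (y.1, Function.update y.2 y.1 s)) :=
  rfl

theorem Fin.le_sub_one_iff_lt {j : Fin (M + 1)} (hj : j ≠ 0) (i : Fin (M + 1)) :
    i ≤ j - 1 ↔ i < j := by
  have := Fin.val_ne_zero_iff.2 hj
  rw [Fin.le_def, Fin.lt_def, Fin.coe_sub_one, if_neg hj]
  omega

/-- The register agreeing with `x` up to site `j`, and with `z` afterwards. -/
def splice {X : Type*} {N : ℕ} (j : Fin N) (x z : Fin N → X) : Fin N → X :=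
  fun i ↦ if i ≤ j then x i else z i

theorem update_splice_zero {X : Type*} {M : ℕ} (x z : Fin (M + 1) → X) (s : X) :
    Function.update (splice 0 x z) 0 s = Function.update z 0 s := by
  funext i
  by_cases hi : i = 0
  · subst hi; simp
  · simp [splice, hi]

theorem update_splice {X : Type*} {M : ℕ} {j : Fin (M + 1)} (hj : j ≠ 0)
    (x z : Fin (M + 1) → X) (s : X) :
    Function.update (splice j x z) j s = splice (j - 1) x (Function.update z j s) := by
  funext i
  by_cases hi : i = j
  · subst hi
    simp [splice, Fin.le_sub_one_iff_lt hj]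
  · simp [splice, Fin.le_sub_one_iff_lt hj, lt_iff_le_and_ne, hi]

theorem exists_catalyticallyReaches_average (hp : ∀ x, 0 ≤ p x) (hp1 : ∑ x, p x = 1)
    (π : Equiv.Perm (Fin (M + 1) → X)) :
    ∃ q, CatalyticallyReaches p q ∧ ∀ g : X → ℝ, ∑ a, q a * g a
      = ((M : ℝ) + 1)⁻¹ * ∑ j, ∑ x : Fin (M + 1) → X, (∏ i, p (x i)) * g (π x j) := by
  classical
  set P : (Fin (M + 1) → X) → ℝ := fun x ↦ ∏ i, p (x i) with hP
  have hP0 (x) : 0 ≤ P x := Finset.prod_nonneg fun i _ ↦ hp _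
  have hP1 : ∑ x, P x = 1 := sum_pi_prod_eq_one hp1 _
  have hM : (0 : ℝ) < M + 1 := by positivity
  set c : Fin (M + 1) × (Fin (M + 1) → X) → ℝ := fun y ↦ ((M : ℝ) + 1)⁻¹ *
    ∑ w : (Fin (M + 1) → X) × (Fin (M + 1) → X) with splice y.1 (π w.1) w.2 = y.2,
      P w.1 * P w.2 with hcdef
  have hc (H : Fin (M + 1) × (Fin (M + 1) → X) → ℝ) : ∑ y, c y * H y
      = ((M : ℝ) + 1)⁻¹ * ∑ j, ∑ x, P x * ∑ z, P z * H (j, splice j (π x) z) := by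
    simp only [hcdef, mul_assoc, ← Finset.mul_sum]
    rw [Fintype.sum_prod_type]
    congr 1
    refine Finset.sum_congr rfl fun j _ ↦ ?_
    dsimp only
    rw [sum_fiberwise_mul (fun w : (Fin (M + 1) → X) × (Fin (M + 1) → X) ↦ splice j (π w.1) w.2)
      (fun w ↦ P w.1 * P w.2) fun y ↦ H (j, y), Fintype.sum_prod_type]
    simp only [Finset.mul_sum, mul_assoc]
  refine ⟨fun a ↦ ((M : ℝ) + 1)⁻¹ *
    ∑ w : Fin (M + 1) × (Fin (M + 1) → X) with π w.2 w.1 = a, P w.2, ?_, ?_⟩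
  swap
  · intro g
    simp only [mul_assoc, ← Finset.mul_sum]
    rw [sum_fiberwise_mul (fun w : Fin (M + 1) × (Fin (M + 1) → X) ↦ π w.2 w.1) (fun w ↦ P w.2) g,
      Fintype.sum_prod_type]
  refine ⟨_, inferInstance, c, fun y ↦ ?_, ?_,
    (exchangeEquiv X (M + 1)).trans (Equiv.prodCongr (Equiv.refl X) (stepEquiv π)), fun g ↦ ?_,
    fun h ↦ ?_⟩
  · exact mul_nonneg (inv_nonneg.2 hM.le)
      (Finset.sum_nonneg fun w _ ↦ mul_nonneg (hP0 _) (hP0 _))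
  · have := hc fun _ ↦ 1
    simp only [mul_one, hP1, Finset.sum_const, Finset.card_univ, Fintype.card_fin, nsmul_eq_mul]
      at this
    rw [this]
    push_cast
    exact inv_mul_cancel₀ hM.ne'
  · have := hc fun y ↦ g (y.2 y.1)
    simp only [splice, le_refl, if_true, ← Finset.sum_mul, hP1, one_mul] at this
    rw [Fintype.sum_prod_type]
    simp only [mul_assoc, ← Finset.mul_sum]
    rw [sum_fiberwise_mul (fun w : Fin (M + 1) × (Fin (M + 1) → X) ↦ π w.2 w.1) (fun w ↦ P w.2) g,
      Fintype.sum_prod_type]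
    simp only [exchangeEquiv_apply, Equiv.trans_apply,
      Equiv.prodCongr_apply, Prod.map, Equiv.refl_apply, this, ← Finset.sum_mul, hp1, one_mul]
  · set K : Fin (M + 1) → (Fin (M + 1) → X) → (Fin (M + 1) → X) → ℝ := fun j x z ↦
      if j = 0 then h (-1, π z) else h (j - 1, splice (j - 1) (π x) z) with hK
    have hstep (j : Fin (M + 1)) (x z : Fin (M + 1) → X) (s : X) :
        h (stepEquiv π (j, Function.update (splice j (π x) z) j s))
          = K j x (Function.update z j s) := by
      by_cases hj : j = 0
      · subst hj
        simp [stepEquiv, hK, update_splice_zero]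
      · simp [stepEquiv, hK, hj, update_splice]
    have hKsum (j : Fin (M + 1)) : ∑ x, P x * ∑ z, P z * K j x z
        = ∑ x, P x * ∑ z, P z * h (j - 1, splice (j - 1) (π x) z) := by
      by_cases hj : j = 0
      · subst hj
        have hlast (x z : Fin (M + 1) → X) : splice (-1) x z = x := by
          funext i
          have hi : i ≤ 0 - 1 := by
            rw [Fin.le_def, Fin.coe_sub_one, if_pos rfl]
            exact Nat.lt_succ_iff.1 i.2
          rw [zero_sub] at hi
          simp only [splice, if_pos hi]
        simp only [hK, if_true, zero_sub, hlast, ← Finset.sum_mul, hP1, one_mul]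
      · simp [hK, hj]
    rw [Fintype.sum_prod_type]
    simp only [exchangeEquiv_apply, Equiv.trans_apply,
      Equiv.prodCongr_apply, Prod.map, mul_assoc, ← Finset.mul_sum]
    simp only [hc fun y ↦ h (stepEquiv π (y.1, Function.update y.2 y.1 _)), hstep]
    rw [hc h, ← Equiv.sum_comp (Equiv.subRight (1 : Fin (M + 1)))]
    simp only [Equiv.subRight_apply, ← hKsum]
    simp only [mul_left_comm _ ((M : ℝ) + 1)⁻¹, ← Finset.mul_sum]
    congr 1
    simp only [Finset.mul_sum]
    rw [Finset.sum_comm]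
    refine Finset.sum_congr rfl fun j _ ↦ ?_
    rw [Finset.sum_comm]
    refine Finset.sum_congr rfl fun x _ ↦ ?_
    simp only [← Finset.mul_sum, mul_left_comm _ (P x)]
    congr 1
    rw [← sum_resample p j (K j x) hp1]
    simp only [Finset.mul_sum, hP]

end Averaging

section EntropyIncrease

variable {X : Type} [Fintype X] {p q : X → ℝ}

theorem mem_closure_catalyticallyReaches (hp : ∀ x, 0 ≤ p x) (hp1 : ∑ x, p x = 1)
    (hq : ∀ x, 0 ≤ q x) (hq1 : ∑ x, q x = 1)
    (hS : ∑ x, Real.negMulLog (p x) < ∑ x, Real.negMulLog (q x)) :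
    q ∈ closure {r | CatalyticallyReaches p r} := by
  classical
  by_contra hmem
  obtain ⟨f, u, hu, huq⟩ := geometric_hahn_banach_closed_point
    (convex_setOf_catalyticallyReaches p).closure isClosed_closure hmem
  set F : X → ℝ := fun x ↦ f (Pi.single x 1) with hF
  have hf (r : X → ℝ) : f r = ∑ x, r x * F x := by
    have hsingle (x : X) : (Pi.single x 1 : X → ℝ) = fun j ↦ if x = j then 1 else 0 := by
      ext j
      simp [Pi.single_apply, eq_comm]
    simpa [hF, hsingle] using (f : (X → ℝ) →ₗ[ℝ] ℝ).pi_apply_eq_sum_univ r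
  rw [hf] at huq
  obtain ⟨N, hN, π, hπ⟩ := exists_perm_lt_sum hp hp1 hq hq1 hS F huq
  obtain ⟨M, rfl⟩ := Nat.exists_eq_succ_of_ne_zero hN.ne'
  obtain ⟨r, hr, hrg⟩ := exists_catalyticallyReaches_average hp hp1 π
  have hlt := hu r (subset_closure hr)
  rw [hf, hrg, inv_mul_lt_iff₀ (by positivity), Finset.sum_comm] at hlt
  simp only [← Finset.mul_sum] at hlt
  push_cast at hπ
  linarith

theorem Convex.interior_closure_eq_interior {V : Type*} [NormedAddCommGroup V] [NormedSpace ℝ V]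
    [FiniteDimensional ℝ V] {s : Set V} (hs : Convex ℝ s) : interior (closure s) = interior s := by
  rcases (interior (closure s)).eq_empty_or_nonempty with h | h
  · rw [h, eq_comm, Set.eq_empty_iff_forall_notMem]
    exact fun x hx ↦ h.subset (interior_mono subset_closure hx)
  · refine hs.interior_closure_eq_interior_of_nonempty_interior ?_
    rw [hs.interior_nonempty_iff_affineSpan_eq_top]
    rw [hs.closure.interior_nonempty_iff_affineSpan_eq_top] at h
    rw [eq_top_iff, ← h, affineSpan_le]
    exact closure_minimal (subset_affineSpan ℝ s) (AffineSubspace.closed_of_finiteDimensional _)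

open scoped Pointwise in
theorem catalyticallyReaches_of_pos (hp : ∀ x, 0 ≤ p x) (hp1 : ∑ x, p x = 1)
    (hq : ∀ x, 0 < q x) (hq1 : ∑ x, q x = 1)
    (hS : ∑ x, Real.negMulLog (p x) < ∑ x, Real.negMulLog (q x)) :
    CatalyticallyReaches p q := by
  have hcard : (Fintype.card X : ℝ) ≠ 0 := by
    rintro h
    rw [Nat.cast_eq_zero, Fintype.card_eq_zero_iff] at h
    simp at hq1
  set R : Set (X → ℝ) := {r | CatalyticallyReaches p r} with hR
  set L : Set (X → ℝ) := ((Submodule.span ℝ {(1 : X → ℝ)} : Submodule ℝ (X → ℝ)) : Set (X → ℝ))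
    with hL
  have hconv : Convex ℝ (R + L) :=
    (convex_setOf_catalyticallyReaches p).add (Submodule.convex _)
  have hshift {v : X → ℝ} (hv : v ∈ closure R) (s : ℝ) : v + s • 1 ∈ closure (R + L) := by
    refine map_mem_closure (f := fun v : X → ℝ ↦ v + s • 1) (by fun_prop) hv fun r hr ↦ ?_
    exact Set.add_mem_add hr (Submodule.smul_mem _ _ (Submodule.mem_span_singleton_self _))
  have hint : q ∈ interior (closure (R + L)) := by
    set T : (X → ℝ) → X → ℝ := fun v ↦ v - ((∑ x, v x - 1) / Fintype.card X) • 1 with hT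
    have hTcont : Continuous T := by fun_prop
    have hTq : T q = q := by simp [hT, hq1]
    have hTsum (v : X → ℝ) : ∑ x, T v x = 1 := by
      simp [hT, mul_div_cancel₀ _ hcard]
    have hpos : ∀ᶠ v in 𝓝 q, ∀ x, 0 < T v x := by
      refine Filter.eventually_all.2 fun x ↦ ?_
      have : Tendsto (fun v ↦ T v x) (𝓝 q) (𝓝 (T q x)) :=
        ((continuous_apply x).comp hTcont).tendsto q
      exact this.eventually (lt_mem_nhds (by rw [hTq]; exact hq x))
    have hent : ∀ᶠ v in 𝓝 q, ∑ x, Real.negMulLog (p x) < ∑ x, Real.negMulLog (T v x) := by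
      have hcont : Continuous fun v ↦ ∑ x, Real.negMulLog (T v x) :=
        continuous_finsetSum _ fun x _ ↦
          Real.continuous_negMulLog.comp ((continuous_apply x).comp hTcont)
      exact (hcont.tendsto q).eventually (lt_mem_nhds (by rwa [hTq]))
    rw [mem_interior_iff_mem_nhds]
    filter_upwards [hpos, hent] with v hv0 hvS
    have := hshift (mem_closure_catalyticallyReaches hp hp1 (fun x ↦ (hv0 x).le) (hTsum v) hvS)
      ((∑ x, v x - 1) / Fintype.card X)
    simpa only [hT, sub_add_cancel] using this
  rw [hconv.interior_closure_eq_interior] at hint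
  obtain ⟨r, hr, l, hl, hrl⟩ := Set.mem_add.1 (interior_subset hint)
  obtain ⟨s, rfl⟩ := Submodule.mem_span_singleton.1 hl
  have hsum := congrArg (fun v ↦ ∑ x, v x) hrl
  simp only [Pi.add_apply, Pi.smul_apply, Pi.one_apply, smul_eq_mul, mul_one,
    Finset.sum_add_distrib, Finset.sum_const, Finset.card_univ, nsmul_eq_mul,
    CatalyticallyReaches.sum_eq hr, hp1, hq1, add_eq_left, mul_eq_zero, hcard, false_or] at hsum
  rwa [← hrl, hsum, zero_smul, add_zero]

theorem catalyticallyReaches_of_entropy_lt (hp : ∀ x, 0 ≤ p x) (hp1 : ∑ x, p x = 1)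
    (hq : ∀ x, 0 ≤ q x) (hq1 : ∑ x, q x = 1)
    (hS : ∑ x, Real.negMulLog (p x) < ∑ x, Real.negMulLog (q x))
    (hsupp : Fintype.card {x // p x ≠ 0} ≤ Fintype.card {x // q x ≠ 0}) :
    CatalyticallyReaches p q := by
  classical
  obtain ⟨e, he⟩ := exists_perm_mapsTo_of_card_le (A := Finset.univ.filter fun x ↦ p x ≠ 0)
    (B := Finset.univ.filter fun x ↦ q x ≠ 0) (by simpa only [Fintype.card_subtype] using hsupp)
  simp only [Finset.mem_filter, Finset.mem_univ, true_and] at he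
  set ι : {x // q x ≠ 0} ↪ X := Function.Embedding.subtype _ with hι
  have hq0 : ∀ x ∉ Set.range ι, q x = 0 := by
    intro x hx
    by_contra h
    exact hx ⟨⟨x, h⟩, rfl⟩
  have hp0 : ∀ x ∉ Set.range ι, (p ∘ e.symm) x = 0 := by
    intro x hx
    by_contra h
    exact hx ⟨⟨x, by simpa using he _ h⟩, rfl⟩
  have hsum {F : X → ℝ} (hF : ∀ x ∉ Set.range ι, F x = 0) : ∑ y, F (ι y) = ∑ x, F x :=
    Fintype.sum_of_injective ι ι.injective _ _ hF fun _ ↦ rfl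
  refine .of_comp_equiv e.symm (.of_comp_embedding ι hp0 hq0
    (catalyticallyReaches_of_pos (fun y ↦ hp _) ?_ (fun y ↦ (hq _).lt_of_ne' y.2) ?_ ?_))
  · rw [← hp1, ← Equiv.sum_comp e.symm]
    exact hsum hp0
  · exact (hsum hq0).trans hq1
  · refine lt_of_eq_of_lt ?_ (hS.trans_eq
      (hsum (F := fun x ↦ Real.negMulLog (q x)) fun x hx ↦ by simp [hq0 x hx]).symm)
    rw [← Equiv.sum_comp e.symm]
    refine hsum (F := fun x ↦ Real.negMulLog (p (e.symm x))) fun x hx ↦ ?_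
    have := hp0 x hx
    simp only [Function.comp_apply] at this
    simp [this]

theorem CatalyticallyReaches.exists_perm_marginals [DecidableEq X] (h : CatalyticallyReaches p q) :
    ∃ (m : ℕ) (c : Fin m → ℝ), (∀ k, 0 ≤ c k) ∧ ∑ k, c k = 1 ∧
      ∃ τ : Equiv.Perm (X × Fin m),
        (∀ x, ∑ k, p (τ (x, k)).1 * c (τ (x, k)).2 = q x) ∧
        ∀ k, ∑ x, p (τ (x, k)).1 * c (τ (x, k)).2 = c k := by
  classical
  obtain ⟨C, _, c, hc0, hc, π, hg, hh⟩ := h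
  set e := Fintype.equivFin C
  set E : X × C ≃ X × Fin (Fintype.card C) := Equiv.prodCongr (Equiv.refl X) e with hE
  have hsum (G : X × C → ℝ) : ∑ z, p z.1 * c z.2 * G (π z)
      = ∑ x, ∑ y, p (π.symm (x, y)).1 * c (π.symm (x, y)).2 * G (x, y) := by
    rw [← Equiv.sum_comp π.symm, Fintype.sum_prod_type]
    simp
  refine ⟨_, c ∘ e.symm, fun k ↦ hc0 _, by simpa using (Equiv.sum_comp e.symm c).trans hc,
    E.symm.trans (π.symm.trans E), fun x ↦ ?_, fun k ↦ ?_⟩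
  · have := hg (Pi.single x 1)
    rw [hsum fun z ↦ (Pi.single x 1 : X → ℝ) z.1] at this
    simp only [Pi.single_apply, mul_ite, mul_one, mul_zero, Finset.sum_ite_irrel,
      Finset.sum_const_zero, Finset.sum_ite_eq', Finset.mem_univ, if_true] at this
    rw [← this, ← Equiv.sum_comp e.symm]
    simp [hE]
  · have := hh (Pi.single (e.symm k) 1)
    rw [hsum fun z ↦ (Pi.single (e.symm k) 1 : C → ℝ) z.2] at this
    simp only [Pi.single_apply, mul_ite, mul_one, mul_zero,
      Finset.sum_ite_eq', Finset.mem_univ, if_true] at this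
    simp [hE, ← this]

end EntropyIncrease

section Unitary

variable {ι κ : Type*} [Fintype ι] [DecidableEq ι] [Fintype κ] [DecidableEq κ]

theorem permMatrix_mul_diagonal_mul_conjTranspose (τ : Equiv.Perm ι) (d : ι → ℂ) :
    τ.permMatrix ℂ * diagonal d * (τ.permMatrix ℂ)ᴴ = diagonal (d ∘ τ) := by
  rw [conjTranspose_permMatrix]
  ext i j
  simp only [mul_apply, diagonal_apply, PEquiv.toMatrix_apply, Equiv.toPEquiv_apply]
  rw [← Equiv.sum_comp τ]
  rcases eq_or_ne i j with rfl | h <;> simp [*]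

theorem permMatrix_mem_unitaryGroup (τ : Equiv.Perm ι) : τ.permMatrix ℂ ∈ unitaryGroup ι ℂ := by
  rw [mem_unitaryGroup_iff, star_eq_conjTranspose, conjTranspose_permMatrix, ← permMatrix_mul]
  simp

theorem ptrace2_kronecker_one_conj {ι κ : Type*} [Fintype ι] [Fintype κ] [DecidableEq κ]
    (A : Matrix ι ι ℂ) (M : Matrix (ι × κ) (ι × κ) ℂ) :
    ptrace2 ((A ⊗ₖ (1 : Matrix κ κ ℂ)) * M * (A ⊗ₖ (1 : Matrix κ κ ℂ))ᴴ)
      = A * ptrace2 M * Aᴴ := by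
  ext i j
  simp only [ptrace2, of_apply, mul_apply, conjTranspose_apply, kroneckerMap_apply,
    Fintype.sum_prod_type, one_apply, mul_ite, mul_one, mul_zero, ite_mul, zero_mul,
    Finset.sum_ite_eq, Finset.mem_univ, if_true, apply_ite star, star_zero, Finset.mul_sum,
    Finset.sum_mul]
  rw [Finset.sum_comm]
  exact Finset.sum_congr rfl fun b _ ↦ Finset.sum_comm

theorem ptrace1_kronecker_one_conj {A : Matrix ι ι ℂ} (hA : A ∈ unitaryGroup ι ℂ)
    (M : Matrix (ι × κ) (ι × κ) ℂ) :
    ptrace1 ((A ⊗ₖ (1 : Matrix κ κ ℂ)) * M * (A ⊗ₖ (1 : Matrix κ κ ℂ))ᴴ) = ptrace1 M := by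
  have hA' (b a : ι) : ∑ i, star (A i b) * A i a = if b = a then 1 else 0 := by
    simpa [mul_apply, one_apply] using congrFun₂ (mem_unitaryGroup_iff'.1 hA) b a
  ext k l
  simp only [ptrace1, of_apply, mul_apply, conjTranspose_apply, kroneckerMap_apply,
    Fintype.sum_prod_type, one_apply, mul_ite, mul_one, mul_zero, ite_mul, zero_mul,
    Finset.sum_ite_eq, Finset.mem_univ, if_true, apply_ite star, star_zero, Finset.sum_mul]
  rw [Finset.sum_comm]
  refine Finset.sum_congr rfl fun b _ ↦ ?_
  rw [Finset.sum_comm]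
  calc _ = ∑ a, M (a, k) (b, l) * ∑ i, star (A i b) * A i a := by
        simp only [Finset.mul_sum]
        exact Finset.sum_congr rfl fun a _ ↦ Finset.sum_congr rfl fun i _ ↦ by ring
    _ = M (b, k) (b, l) := by simp only [hA', mul_ite, mul_one, mul_zero,
        Finset.sum_ite_eq, Finset.mem_univ, if_true]

theorem ptrace2_diagonal {ι κ : Type*} [DecidableEq ι] [Fintype κ] [DecidableEq κ] (d : ι × κ → ℂ) :
    ptrace2 (diagonal d) = diagonal fun i ↦ ∑ k, d (i, k) := by
  ext i j
  by_cases h : i = j <;> simp [ptrace2, diagonal_apply, h]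

theorem ptrace1_diagonal {ι κ : Type*} [Fintype ι] [DecidableEq ι] [DecidableEq κ] (d : ι × κ → ℂ) :
    ptrace1 (diagonal d) = diagonal fun k ↦ ∑ i, d (i, k) := by
  ext i j
  by_cases h : i = j <;> simp [ptrace1, diagonal_apply, h]

theorem exists_unitary_ptrace_eq {A A' : Matrix ι ι ℂ} (hA : A ∈ unitaryGroup ι ℂ)
    (hA' : A' ∈ unitaryGroup ι ℂ) {p q : ι → ℝ} {c : κ → ℝ} (τ : Equiv.Perm (ι × κ))
    (hq : ∀ x, ∑ k, p (τ (x, k)).1 * c (τ (x, k)).2 = q x)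
    (hc : ∀ k, ∑ x, p (τ (x, k)).1 * c (τ (x, k)).2 = c k) :
    ∃ U ∈ unitaryGroup (ι × κ) ℂ,
      ptrace2 (U * ((A * diagonal (fun i ↦ (p i : ℂ)) * Aᴴ) ⊗ₖ diagonal fun k ↦ (c k : ℂ)) * Uᴴ)
        = A' * diagonal (fun i ↦ (q i : ℂ)) * A'ᴴ ∧
      ptrace1 (U * ((A * diagonal (fun i ↦ (p i : ℂ)) * Aᴴ) ⊗ₖ diagonal fun k ↦ (c k : ℂ)) * Uᴴ)
        = diagonal fun k ↦ (c k : ℂ) := by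
  set W : Matrix (ι × κ) (ι × κ) ℂ := A ⊗ₖ 1 with hW
  set W' : Matrix (ι × κ) (ι × κ) ℂ := A' ⊗ₖ 1 with hW'
  set D : Matrix (ι × κ) (ι × κ) ℂ := diagonal fun z ↦ ((p z.1 : ℂ) * (c z.2 : ℂ))
  have hWu : W ∈ unitaryGroup (ι × κ) ℂ := kronecker_mem_unitary hA (one_mem _)
  have hWu' : W' ∈ unitaryGroup (ι × κ) ℂ := kronecker_mem_unitary hA' (one_mem _)
  have hstate : (A * diagonal (fun i ↦ (p i : ℂ)) * Aᴴ) ⊗ₖ diagonal (fun k ↦ (c k : ℂ))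
      = W * D * Wᴴ := by
    have hD' : D = diagonal (fun i ↦ (p i : ℂ)) ⊗ₖ diagonal fun k ↦ (c k : ℂ) :=
      (diagonal_kronecker_diagonal (fun i ↦ (p i : ℂ)) fun k ↦ (c k : ℂ)).symm
    rw [hD', hW, conjTranspose_kronecker, ← mul_kronecker_mul, ← mul_kronecker_mul]
    simp
  have hconj : (W' * τ.permMatrix ℂ * Wᴴ) * (W * D * Wᴴ) * (W' * τ.permMatrix ℂ * Wᴴ)ᴴ
      = W' * diagonal ((fun z ↦ ((p z.1 : ℂ) * (c z.2 : ℂ))) ∘ τ) * W'ᴴ := by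
    have hWW : Wᴴ * W = 1 := mem_unitaryGroup_iff'.1 hWu
    calc _ = W' * τ.permMatrix ℂ * (Wᴴ * W) * D * (Wᴴ * W) * (τ.permMatrix ℂ)ᴴ * W'ᴴ := by
          simp only [conjTranspose_mul, conjTranspose_conjTranspose, Matrix.mul_assoc]
      _ = W' * (τ.permMatrix ℂ * D * (τ.permMatrix ℂ)ᴴ) * W'ᴴ := by
          simp only [hWW, Matrix.mul_one, Matrix.mul_assoc]
      _ = _ := by rw [permMatrix_mul_diagonal_mul_conjTranspose]
  refine ⟨W' * τ.permMatrix ℂ * Wᴴ,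
    mul_mem (mul_mem hWu' (permMatrix_mem_unitaryGroup τ)) (Unitary.star_mem hWu), ?_, ?_⟩
  · rw [hstate, hconj, ptrace2_kronecker_one_conj, ptrace2_diagonal]
    simp only [Function.comp_apply, ← Complex.ofReal_mul, ← Complex.ofReal_sum, hq]
  · rw [hstate, hconj, ptrace1_kronecker_one_conj hA', ptrace1_diagonal]
    simp only [Function.comp_apply, ← Complex.ofReal_mul, ← Complex.ofReal_sum, hc]

end Unitary

theorem CatalyticallyReaches.kronecker_mm_one {n : ℕ} {p q : Fin n → ℝ}
    (h : CatalyticallyReaches p q) :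
    CatalyticallyReaches (fun i : Fin n × Fin 1 ↦ p i.1) fun i ↦ q i.1 := by
  set ι : Fin n ↪ Fin n × Fin 1 := (Equiv.prodUnique (Fin n) (Fin 1)).symm.toEmbedding with hι
  have hι' (x : Fin n × Fin 1) : x ∈ Set.range ι := ⟨x.1, Equiv.symm_apply_apply _ x⟩
  exact .of_comp_embedding ι (fun x hx ↦ (hx (hι' x)).elim) (fun x hx ↦ (hx (hι' x)).elim) h

theorem Matrix.IsHermitian.kronecker_mm_one {n : ℕ} {ρ : Matrix (Fin n) (Fin n) ℂ}
    (h : ρ.IsHermitian) : ∃ A ∈ unitaryGroup (Fin n × Fin 1) ℂ,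
      ρ ⊗ₖ mm 1 = A * diagonal (fun i ↦ (h.eigenvalues i.1 : ℂ)) * Aᴴ := by
  refine ⟨(h.eigenvectorUnitary : Matrix (Fin n) (Fin n) ℂ) ⊗ₖ 1,
    kronecker_mem_unitary h.eigenvectorUnitary.2 (one_mem _), ?_⟩
  have hmm : mm 1 = 1 := by simp [mm]
  have hdiag : (diagonal fun i : Fin n × Fin 1 ↦ (h.eigenvalues i.1 : ℂ))
      = diagonal (fun i ↦ (h.eigenvalues i : ℂ)) ⊗ₖ 1 := by
    rw [← diagonal_one, diagonal_kronecker_diagonal]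
    simp
  rw [hdiag, conjTranspose_kronecker, ← mul_kronecker_mul, ← mul_kronecker_mul, hmm]
  conv_lhs => rw [h.spectral_theorem]
  simp [Unitary.conjStarAlgAut_apply, star_eq_conjTranspose, Function.comp_def]

theorem IsDensityMatrix.sum_eigenvalues {n : ℕ} {ρ : Matrix (Fin n) (Fin n) ℂ}
    (h : IsDensityMatrix ρ) : ∑ i, h.1.isHermitian.eigenvalues i = 1 := by
  have := h.1.isHermitian.trace_eq_sum_eigenvalues.symm.trans h.2
  simp only [Complex.coe_algebraMap] at this
  exact_mod_cast this

theorem isDensityMatrix_diagonal {m : ℕ} {c : Fin m → ℝ} (hc0 : ∀ k, 0 ≤ c k)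
    (hc : ∑ k, c k = 1) : IsDensityMatrix (diagonal fun k ↦ (c k : ℂ)) := by
  refine ⟨PosSemidef.diagonal fun k ↦ by simpa using hc0 k, ?_⟩
  rw [trace_diagonal]
  exact_mod_cast hc

/-- weak solution to the catalytic entropy conjecture, forward direction.
If `S(ρ') > S(ρ)` and `rank ρ' ≥ rank ρ`, then there are a finite dimension `d`, a catalyst
`σ` and a unitary `U` on system ⊗ ancilla ⊗ catalyst with
`tr_C[U(ρ ⊗ 𝟙_d ⊗ σ)U†] = ρ' ⊗ 𝟙_d` and `tr_{A,R}[U(ρ ⊗ 𝟙_d ⊗ σ)U†] = σ`. -/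
theorem stmt2 {n : ℕ} (ρ ρ' : Matrix (Fin n) (Fin n) ℂ)
    (hρ : IsDensityMatrix ρ) (hρ' : IsDensityMatrix ρ')
    (hspec : spectra ρ ≠ spectra ρ')
    (hS : vN ρ < vN ρ') (hrank : ρ.rank ≤ ρ'.rank) :
    ∃ (d m : ℕ), 0 < d ∧
      ∃ σ : Matrix (Fin m) (Fin m) ℂ, IsDensityMatrix σ ∧
        ∃ U ∈ Matrix.unitaryGroup ((Fin n × Fin d) × Fin m) ℂ,
          ptrace2 (U * ((ρ ⊗ₖ mm d) ⊗ₖ σ) * Uᴴ) = ρ' ⊗ₖ mm d ∧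
          ptrace1 (U * ((ρ ⊗ₖ mm d) ⊗ₖ σ) * Uᴴ) = σ := by
  have hreach : CatalyticallyReaches hρ.1.isHermitian.eigenvalues
      hρ'.1.isHermitian.eigenvalues := by
    refine catalyticallyReaches_of_entropy_lt hρ.1.eigenvalues_nonneg hρ.sum_eigenvalues
      hρ'.1.eigenvalues_nonneg hρ'.sum_eigenvalues ?_ ?_
    · simpa only [vN, eigs, dif_pos hρ.1.isHermitian, dif_pos hρ'.1.isHermitian] using hS
    · rwa [hρ.1.isHermitian.rank_eq_card_non_zero_eigs,
        hρ'.1.isHermitian.rank_eq_card_non_zero_eigs] at hrank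
  obtain ⟨m, c, hc0, hc, τ, hτq, hτc⟩ := hreach.kronecker_mm_one.exists_perm_marginals
  obtain ⟨A, hA, hAρ⟩ := hρ.1.isHermitian.kronecker_mm_one
  obtain ⟨A', hA', hAρ'⟩ := hρ'.1.isHermitian.kronecker_mm_one
  refine ⟨1, m, one_pos, _, isDensityMatrix_diagonal hc0 hc, ?_⟩
  rw [hAρ, hAρ']
  exact exists_unitary_ptrace_eq hA hA' τ hτq hτc
end
end

section
/- Let ρ and ρ' be density matrices of the same finite dimension with different spectra. Suppose there exists a finite-dimensional density matrix σ and a unitary U on the joint space such that tr₂[U(ρ ⊗ σ)U†] = ρ' and tr₁[U(ρ ⊗ σ)U†] = σ. Then S(ρ') > S(ρ) and rank(ρ') ≥ rank(ρ). -/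
open scoped Kronecker ComplexOrder
open Matrix

noncomputable section

/-- The pointwise relative entropy `x log x - x log y - x + y` is nonnegative. -/
lemma klTerm_nonneg {x y : ℝ} (hx : 0 ≤ x) (hy : 0 < y) :
    0 ≤ x * Real.log x - x * Real.log y - x + y := by
  rcases hx.eq_or_lt with rfl | hx
  · simpa using hy.le
  · have h := Real.log_le_sub_one_of_pos (div_pos hy hx)
    rw [Real.log_div hy.ne' hx.ne'] at h
    have h2 := mul_le_mul_of_nonneg_left h hx.le
    have h3 : x * (y / x - 1) = y - x := by field_simp
    linarith

/-- The pointwise relative entropy vanishes only on the diagonal. -/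
lemma eq_of_klTerm_eq_zero {x y : ℝ} (hx : 0 ≤ x) (hy : 0 < y)
    (h0 : x * Real.log x - x * Real.log y - x + y = 0) : x = y := by
  rcases hx.eq_or_lt with rfl | hx
  · simpa using h0.symm
  · by_contra hne
    have hne' : y / x ≠ 1 := fun h => hne ((div_eq_one_iff_eq hx.ne').1 h).symm
    have h := Real.log_lt_sub_one_of_pos (div_pos hy hx) hne'
    rw [Real.log_div hy.ne' hx.ne'] at h
    have h2 := mul_lt_mul_of_pos_left h hx
    have h3 : x * (y / x - 1) = y - x := by field_simp
    linarith

/-- The power sums of a finite real family determine its multiset of values. -/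
lemma map_univ_eq_of_sum_pow_eq {ι : Type*} [Fintype ι] {p p' : ι → ℝ}
    (h : ∀ k : ℕ, ∑ i, p i ^ k = ∑ i, p' i ^ k) :
    (Finset.univ.val.map p : Multiset ℝ) = Finset.univ.val.map p' := by
  classical
  have hpoly : ∀ f : Polynomial ℝ, ∑ i, f.eval (p i) = ∑ i, f.eval (p' i) := by
    intro f
    simp only [Polynomial.eval_eq_sum_range]
    rw [Finset.sum_comm, Finset.sum_comm (s := Finset.univ (α := ι))]
    exact Finset.sum_congr rfl fun k _ => by rw [← Finset.mul_sum, ← Finset.mul_sum, h k]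
  ext a
  let S : Finset ℝ := (Finset.univ.image p ∪ Finset.univ.image p').erase a
  let f : Polynomial ℝ := ∏ x ∈ S, (Polynomial.X - Polynomial.C x)
  have hfa : f.eval a ≠ 0 := by
    simp only [f, Polynomial.eval_prod, Polynomial.eval_sub, Polynomial.eval_X, Polynomial.eval_C]
    exact Finset.prod_ne_zero_iff.2 fun x hx => sub_ne_zero.2 (Finset.ne_of_mem_erase hx).symm
  have hf0 : ∀ x ∈ S, f.eval x = 0 := by
    intro x hx
    simp only [f, Polynomial.eval_prod, Polynomial.eval_sub, Polynomial.eval_X, Polynomial.eval_C]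
    exact Finset.prod_eq_zero hx (sub_self x)
  have hcount : ∀ g : ι → ℝ, (∀ i, g i ≠ a → g i ∈ S) →
      ∑ i, f.eval (g i) = (Finset.univ.val.map g).count a * f.eval a := by
    intro g hg
    rw [Multiset.count_map, ← Finset.filter_val, Finset.card_val, ← nsmul_eq_mul,
      ← Finset.sum_const, Finset.sum_filter]
    refine Finset.sum_congr rfl fun i _ => ?_
    split_ifs with hi
    · rw [← hi]
    · exact hf0 _ (hg i (Ne.symm hi))
  have h1 := hcount p fun i hi => by simp [S, hi]
  have h2 := hcount p' fun i hi => by simp [S, hi]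
  have h3 := hpoly f
  rw [h1, h2] at h3
  exact_mod_cast mul_right_cancel₀ hfa h3

section Stochastic

variable {X : Type*} [Fintype X] {B : X → X → ℝ} {r s : X → ℝ}

/-- If a doubly stochastic kernel `B` maps the vector `r` into the support of `s`, then the
support of `r` is no larger than the support of `s`. -/
lemma card_support_le_of_doublyStochastic (hB : ∀ x y, 0 ≤ B x y)
    (hrow : ∀ x, ∑ y, B x y = 1) (hcol : ∀ y, ∑ x, B x y = 1)
    (hsupp : ∀ x y, s x = 0 → B x y * r y = 0) :
    Fintype.card {y // r y ≠ 0} ≤ Fintype.card {x // s x ≠ 0} := by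
  classical
  rw [Fintype.card_subtype, Fintype.card_subtype, ← Nat.cast_le (α := ℝ)]
  calc ((Finset.univ.filter fun y => r y ≠ 0).card : ℝ)
      = ∑ y with r y ≠ 0, ∑ x, B x y := by simp [hcol]
    _ = ∑ y with r y ≠ 0, ∑ x with s x ≠ 0, B x y := by
        refine Finset.sum_congr rfl fun y hy => (Finset.sum_filter_of_ne ?_).symm
        intro x _ hx hs
        exact hx ((mul_eq_zero.1 (hsupp x y hs)).resolve_right (Finset.mem_filter.1 hy).2)
    _ = ∑ x with s x ≠ 0, ∑ y with r y ≠ 0, B x y := Finset.sum_comm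
    _ ≤ ∑ x with s x ≠ 0, ∑ y, B x y := Finset.sum_le_sum fun x _ =>
        Finset.sum_le_sum_of_subset_of_nonneg (Finset.filter_subset _ _) fun y _ _ => hB x y
    _ = ((Finset.univ.filter fun x => s x ≠ 0).card : ℝ) := by simp [hrow]

/-- Klein's inequality for a doubly stochastic kernel `B`, with its equality case:
equality forces `r` and `s` to agree along the support of `B`. -/
lemma entropy_lt_or_eq_of_doublyStochastic (hB : ∀ x y, 0 ≤ B x y)
    (hrow : ∀ x, ∑ y, B x y = 1) (hcol : ∀ y, ∑ x, B x y = 1)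
    (hr : ∀ y, 0 ≤ r y) (hs : ∀ x, 0 ≤ s x) (hsum : ∑ y, r y = ∑ x, s x)
    (hsupp : ∀ x y, s x = 0 → B x y * r y = 0) :
    ∑ y, Real.negMulLog (r y) < -∑ x, (∑ y, B x y * r y) * Real.log (s x) ∨
      ∀ x y, B x y ≠ 0 → r y = s x := by
  have key : -∑ x, (∑ y, B x y * r y) * Real.log (s x) - ∑ y, Real.negMulLog (r y) =
      ∑ x, ∑ y, B x y * (r y * Real.log (r y) - r y * Real.log (s x) - r y + s x) := by
    have e1 : ∑ x, ∑ y, B x y * (r y * Real.log (r y)) = ∑ y, r y * Real.log (r y) := by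
      rw [Finset.sum_comm]; simp [← Finset.sum_mul, hcol]
    have e2 : ∑ x, ∑ y, B x y * r y = ∑ y, r y := by
      rw [Finset.sum_comm]; simp [← Finset.sum_mul, hcol]
    have e3 : ∑ x, ∑ y, B x y * s x = ∑ x, s x := by
      simp [← Finset.sum_mul, hrow]
    simp only [mul_add, mul_sub, Finset.sum_add_distrib, Finset.sum_sub_distrib, e1, e2, e3,
      Real.negMulLog_eq_neg, Finset.sum_neg_distrib, Finset.sum_mul, hsum, mul_assoc]
    ring
  have hterm : ∀ x y,
      0 ≤ B x y * (r y * Real.log (r y) - r y * Real.log (s x) - r y + s x) := by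
    intro x y
    rcases (hs x).eq_or_lt with h | h
    · rcases mul_eq_zero.1 (hsupp x y h.symm) with h' | h' <;> simp [h', ← h]
    · exact mul_nonneg (hB x y) (klTerm_nonneg (hr y) h)
  have hnonneg := Finset.sum_nonneg fun x (_ : x ∈ Finset.univ) =>
    Finset.sum_nonneg fun y (_ : y ∈ Finset.univ) => hterm x y
  rcases hnonneg.eq_or_lt with h0 | h0
  · refine Or.inr fun x y hxy => ?_
    have hx := (Finset.sum_eq_zero_iff_of_nonneg fun x _ =>
      Finset.sum_nonneg fun y _ => hterm x y).1 h0.symm x (Finset.mem_univ x)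
    have hy := (Finset.sum_eq_zero_iff_of_nonneg fun y _ => hterm x y).1 hx y (Finset.mem_univ y)
    rcases (hs x).eq_or_lt with h | h
    · rw [← h]
      exact (mul_eq_zero.1 (hsupp x y h.symm)).resolve_left hxy
    · exact eq_of_klTerm_eq_zero (hr y) h ((mul_eq_zero.1 hy).resolve_left hxy)
  · exact Or.inl (by linarith)

/-- If `r` and `s` agree along the support of a doubly stochastic kernel, they have the same
power sums. -/
lemma sum_pow_eq_of_doublyStochastic (hrow : ∀ x, ∑ y, B x y = 1) (hcol : ∀ y, ∑ x, B x y = 1)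
    (h : ∀ x y, B x y ≠ 0 → r y = s x) (k : ℕ) : ∑ y, r y ^ k = ∑ x, s x ^ k := by
  calc ∑ y, r y ^ k = ∑ y, ∑ x, B x y * r y ^ k := by simp [← Finset.sum_mul, hcol]
    _ = ∑ y, ∑ x, B x y * s x ^ k := by
        refine Finset.sum_congr rfl fun y _ => Finset.sum_congr rfl fun x _ => ?_
        by_cases hxy : B x y = 0
        · simp [hxy]
        · rw [h x y hxy]
    _ = ∑ x, s x ^ k := by rw [Finset.sum_comm]; simp [← Finset.sum_mul, hrow]

end Stochastic

section Product

variable {α β : Type*} [Fintype α] [Fintype β]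

/-- The Shannon entropy is additive on products of probability vectors. -/
lemma sum_negMulLog_mul {p : α → ℝ} {q : β → ℝ} (hp : ∑ i, p i = 1) (hq : ∑ j, q j = 1) :
    ∑ x : α × β, Real.negMulLog (p x.1 * q x.2) =
      ∑ i, Real.negMulLog (p i) + ∑ j, Real.negMulLog (q j) := by
  simp only [Real.negMulLog_mul, Fintype.sum_prod_type, Finset.sum_add_distrib,
    ← Finset.sum_mul, ← Finset.mul_sum, hp, hq, one_mul]

lemma card_mul_ne_zero (p : α → ℝ) (q : β → ℝ) :
    Fintype.card {x : α × β // p x.1 * q x.2 ≠ 0} =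
      Fintype.card {i // p i ≠ 0} * Fintype.card {j // q j ≠ 0} := by
  rw [← Fintype.card_prod]
  exact Fintype.card_congr ((Equiv.subtypeEquivRight fun x => mul_ne_zero_iff).trans
    (Equiv.subtypeProdEquivProd (p := fun i => p i ≠ 0) (q := fun j => q j ≠ 0)))

/-- The classical catalytic transition: a doubly stochastic kernel on a product space that sends
`p ⊗ q` to a distribution with marginals `p'` and `q`. -/
lemma catalytic_of_doublyStochastic {p p' : α → ℝ} {q : β → ℝ} {B : α × β → α × β → ℝ}
    (hB : ∀ x y, 0 ≤ B x y) (hrow : ∀ x, ∑ y, B x y = 1) (hcol : ∀ y, ∑ x, B x y = 1)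
    (hp : ∀ i, 0 ≤ p i) (hp' : ∀ i, 0 ≤ p' i) (hq : ∀ j, 0 ≤ q j)
    (hp1 : ∑ i, p i = 1) (hp1' : ∑ i, p' i = 1) (hq1 : ∑ j, q j = 1)
    (hfst : ∀ i, ∑ j, ∑ y, B (i, j) y * (p y.1 * q y.2) = p' i)
    (hsnd : ∀ j, ∑ i, ∑ y, B (i, j) y * (p y.1 * q y.2) = q j)
    (hne : (Finset.univ.val.map p : Multiset ℝ) ≠ Finset.univ.val.map p') :
    ∑ i, Real.negMulLog (p i) < ∑ i, Real.negMulLog (p' i) ∧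
      Fintype.card {i // p i ≠ 0} ≤ Fintype.card {i // p' i ≠ 0} := by
  have hr : ∀ y : α × β, 0 ≤ p y.1 * q y.2 := fun y => mul_nonneg (hp _) (hq _)
  have hs : ∀ x : α × β, 0 ≤ p' x.1 * q x.2 := fun x => mul_nonneg (hp' _) (hq _)
  have hBr : ∀ x y, 0 ≤ B x y * (p y.1 * q y.2) := fun x y => mul_nonneg (hB x y) (hr y)
  have hBr' : ∀ x, 0 ≤ ∑ y, B x y * (p y.1 * q y.2) :=
    fun x => Finset.sum_nonneg fun y _ => hBr x y
  have ht1 : ∀ i j, p' i = 0 → ∑ y, B (i, j) y * (p y.1 * q y.2) = 0 := fun i j h =>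
    (Finset.sum_eq_zero_iff_of_nonneg fun j _ => hBr' (i, j)).1 ((hfst i).trans h) j
      (Finset.mem_univ j)
  have ht2 : ∀ i j, q j = 0 → ∑ y, B (i, j) y * (p y.1 * q y.2) = 0 := fun i j h =>
    (Finset.sum_eq_zero_iff_of_nonneg fun i _ => hBr' (i, j)).1 ((hsnd j).trans h) i
      (Finset.mem_univ i)
  have ht : ∀ x : α × β, p' x.1 * q x.2 = 0 → ∑ y, B x y * (p y.1 * q y.2) = 0 := by
    rintro ⟨i, j⟩ h
    exact (mul_eq_zero.1 h).elim (ht1 i j) (ht2 i j)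
  have hsupp : ∀ x y : α × β, p' x.1 * q x.2 = 0 → B x y * (p y.1 * q y.2) = 0 := fun x y h =>
    (Finset.sum_eq_zero_iff_of_nonneg fun y _ => hBr x y).1 (ht x h) y (Finset.mem_univ y)
  have hqex : ∃ j, 0 < q j := by
    by_contra! hcon
    have : ∑ j, q j ≤ 0 := Finset.sum_nonpos fun j _ => hcon j
    linarith
  obtain ⟨j₀, hj₀⟩ := hqex
  constructor
  · have hcross : -∑ x : α × β, (∑ y, B x y * (p y.1 * q y.2)) * Real.log (p' x.1 * q x.2) =
        ∑ i, Real.negMulLog (p' i) + ∑ j, Real.negMulLog (q j) := by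
      have hlog : ∀ x : α × β,
          (∑ y, B x y * (p y.1 * q y.2)) * Real.log (p' x.1 * q x.2) =
            (∑ y, B x y * (p y.1 * q y.2)) * Real.log (p' x.1) +
            (∑ y, B x y * (p y.1 * q y.2)) * Real.log (q x.2) := by
        rintro ⟨i, j⟩
        by_cases h1 : p' i = 0
        · simp [ht1 i j h1]
        by_cases h2 : q j = 0
        · simp [ht2 i j h2]
        rw [Real.log_mul h1 h2, mul_add]
      simp only [hlog, Finset.sum_add_distrib]
      rw [Fintype.sum_prod_type, Fintype.sum_prod_type_right]
      simp only [← Finset.sum_mul, hfst, hsnd, Real.negMulLog_eq_neg, Finset.sum_neg_distrib]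
      ring
    have hsum : ∑ y : α × β, p y.1 * q y.2 = ∑ x : α × β, p' x.1 * q x.2 := by
      simp only [Fintype.sum_prod_type, ← Finset.mul_sum, hq1, mul_one, hp1, hp1']
    rcases entropy_lt_or_eq_of_doublyStochastic hB hrow hcol hr hs hsum hsupp with h | h
    · rw [hcross, sum_negMulLog_mul hp1 hq1] at h
      linarith
    · refine absurd (map_univ_eq_of_sum_pow_eq fun k => ?_) hne
      have hk := sum_pow_eq_of_doublyStochastic hrow hcol h k
      simp only [mul_pow, Fintype.sum_prod_type, ← Finset.mul_sum, ← Finset.sum_mul] at hk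
      refine mul_right_cancel₀ (ne_of_gt ?_) hk
      exact Finset.sum_pos' (fun j _ => pow_nonneg (hq j) k) ⟨j₀, Finset.mem_univ _, pow_pos hj₀ k⟩
  · have h := card_support_le_of_doublyStochastic hB hrow hcol hsupp
    rw [card_mul_ne_zero, card_mul_ne_zero] at h
    exact Nat.le_of_mul_le_mul_right h (Fintype.card_pos_iff.2 ⟨⟨j₀, hj₀.ne'⟩⟩)

end Product

section PartialTrace

variable {α β : Type*} [Fintype α] [Fintype β]

/-- The partial trace over the second factor is covariant under local unitaries. -/
lemma ptrace2_kronecker_conj [DecidableEq β] (C : Matrix α α ℂ) {D : Matrix β β ℂ}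
    (hD : D ∈ Matrix.unitaryGroup β ℂ) (M : Matrix (α × β) (α × β) ℂ) :
    ptrace2 ((C ⊗ₖ D)ᴴ * M * (C ⊗ₖ D)) = Cᴴ * ptrace2 M * C := by
  have hDD : ∀ b d, ∑ l, D d l * star (D b l) = if d = b then 1 else 0 := fun b d => by
    have h := congrFun (congrFun (Matrix.mem_unitaryGroup_iff.1 hD) d) b
    simpa [Matrix.mul_apply, Matrix.one_apply] using h
  ext k k'
  calc ∑ l, ((C ⊗ₖ D)ᴴ * M * (C ⊗ₖ D)) (k, l) (k', l)
      = ∑ l, ∑ c, ∑ d, ∑ a, ∑ b, star (C a k) * M (a, b) (c, d) * C c k' *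
          (D d l * star (D b l)) := by
        simp only [Matrix.mul_apply, Fintype.sum_prod_type, Finset.sum_mul,
          Matrix.conjTranspose_apply, Matrix.kroneckerMap_apply, star_mul']
        refine Finset.sum_congr rfl fun _ _ => Finset.sum_congr rfl fun _ _ =>
          Finset.sum_congr rfl fun _ _ => Finset.sum_congr rfl fun _ _ =>
          Finset.sum_congr rfl fun _ _ => by ring
    _ = ∑ c, ∑ d, ∑ a, ∑ b, star (C a k) * M (a, b) (c, d) * C c k' *
          ∑ l, D d l * star (D b l) := by
        simp only [Finset.mul_sum]
        rw [Finset.sum_comm]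
        refine Finset.sum_congr rfl fun _ _ => ?_
        rw [Finset.sum_comm]
        refine Finset.sum_congr rfl fun _ _ => ?_
        rw [Finset.sum_comm]
        refine Finset.sum_congr rfl fun _ _ => ?_
        rw [Finset.sum_comm]
    _ = ∑ c, ∑ a, ∑ d, star (C a k) * M (a, d) (c, d) * C c k' := by
        simp only [hDD, mul_ite, mul_one, mul_zero, Finset.sum_ite_eq, Finset.mem_univ, if_true]
        exact Finset.sum_congr rfl fun _ _ => Finset.sum_comm
    _ = (Cᴴ * ptrace2 M * C) k k' := by
        simp only [Matrix.mul_apply, ptrace2, Matrix.of_apply, Matrix.conjTranspose_apply,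
          Finset.sum_mul, Finset.mul_sum]

/-- The partial trace over the first factor is covariant under local unitaries. -/
lemma ptrace1_kronecker_conj [DecidableEq α] {C : Matrix α α ℂ} (hC : C ∈ Matrix.unitaryGroup α ℂ)
    (D : Matrix β β ℂ) (M : Matrix (α × β) (α × β) ℂ) :
    ptrace1 ((C ⊗ₖ D)ᴴ * M * (C ⊗ₖ D)) = Dᴴ * ptrace1 M * D := by
  have hswap : (C ⊗ₖ D).submatrix (Equiv.prodComm β α) (Equiv.prodComm β α) = D ⊗ₖ C := by
    ext ⟨a, b⟩ ⟨c, d⟩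
    simp [mul_comm]
  have h := ptrace2_kronecker_conj D hC (M.submatrix (Equiv.prodComm β α) (Equiv.prodComm β α))
  rw [← hswap, Matrix.conjTranspose_submatrix, Matrix.submatrix_mul_equiv,
    Matrix.submatrix_mul_equiv] at h
  exact h

end PartialTrace

section Spectral

variable {α : Type*} [Fintype α] [DecidableEq α]

lemma eigs_eq {M : Matrix α α ℂ} (hM : M.IsHermitian) : eigs M = hM.eigenvalues :=
  dif_pos hM

lemma exists_unitary_conj_eq_diagonal_eigs {M : Matrix α α ℂ} (hM : M.IsHermitian) :
    ∃ V ∈ Matrix.unitaryGroup α ℂ, Vᴴ * M * V = Matrix.diagonal fun i => (eigs M i : ℂ) := by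
  refine ⟨hM.eigenvectorUnitary, hM.eigenvectorUnitary.2, ?_⟩
  have h := hM.conjStarAlgAut_star_eigenvectorUnitary
  rw [Unitary.conjStarAlgAut_apply] at h
  rw [eigs_eq hM]
  simpa [Function.comp_def, Matrix.star_eq_conjTranspose] using h

lemma IsDensityMatrix.eigs_nonneg {M : Matrix α α ℂ} (hM : IsDensityMatrix M) (i : α) :
    0 ≤ eigs M i := by
  rw [eigs_eq hM.1.isHermitian]
  exact hM.1.eigenvalues_nonneg i

lemma IsDensityMatrix.sum_eigs {M : Matrix α α ℂ} (hM : IsDensityMatrix M) :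
    ∑ i, eigs M i = 1 := by
  have h := hM.2.symm.trans hM.1.isHermitian.trace_eq_sum_eigenvalues
  rw [eigs_eq hM.1.isHermitian]
  exact Complex.ofReal_injective (by simpa using h.symm)

lemma rank_eq_card_eigs_ne_zero {M : Matrix α α ℂ} (hM : M.IsHermitian) :
    M.rank = Fintype.card {i // eigs M i ≠ 0} := by
  rw [hM.rank_eq_card_non_zero_eigs]
  exact Fintype.card_congr (Equiv.subtypeEquivRight fun i => by rw [eigs_eq hM])

/-- The squared moduli of the entries of a unitary matrix sum to one along each row. -/
lemma sum_normSq_row {A : Matrix α α ℂ} (hA : A ∈ Matrix.unitaryGroup α ℂ) (x : α) :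
    ∑ y, Complex.normSq (A x y) = 1 := by
  have h := congrFun (congrFun (Matrix.mem_unitaryGroup_iff.1 hA) x) x
  simp only [Matrix.mul_apply, Matrix.star_apply, Complex.star_def, Complex.mul_conj,
    Matrix.one_apply_eq] at h
  exact_mod_cast h

/-- The squared moduli of the entries of a unitary matrix sum to one along each column. -/
lemma sum_normSq_col {A : Matrix α α ℂ} (hA : A ∈ Matrix.unitaryGroup α ℂ) (y : α) :
    ∑ x, Complex.normSq (A x y) = 1 := by
  have h := sum_normSq_row (Unitary.star_mem hA) y
  simpa [Matrix.star_apply] using h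

lemma conj_diagonal_apply_self (A : Matrix α α ℂ) (r : α → ℝ) (x : α) :
    (A * (Matrix.diagonal fun y => (r y : ℂ)) * Aᴴ) x x =
      ((∑ y, Complex.normSq (A x y) * r y : ℝ) : ℂ) := by
  simp only [Matrix.mul_apply (N := Aᴴ), Matrix.mul_diagonal, Matrix.conjTranspose_apply,
    Complex.star_def, Complex.ofReal_sum, Complex.ofReal_mul, ← Complex.mul_conj]
  exact Finset.sum_congr rfl fun y _ => by ring

end Spectral

/-- easy direction of the catalytic entropy conjecture. If density
matrices `ρ, ρ'` with different spectra admit a correlating-catalytic transition, then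
`S(ρ') > S(ρ)` and `rank ρ' ≥ rank ρ`. -/
theorem stmt4 {n : ℕ} (ρ ρ' : Matrix (Fin n) (Fin n) ℂ)
    (hρ : IsDensityMatrix ρ) (hρ' : IsDensityMatrix ρ')
    (hspec : spectra ρ ≠ spectra ρ')
    (h : ∃ (m : ℕ) (σ : Matrix (Fin m) (Fin m) ℂ),
      IsDensityMatrix σ ∧
      ∃ U ∈ Matrix.unitaryGroup (Fin n × Fin m) ℂ,
        ptrace2 (U * (ρ ⊗ₖ σ) * Uᴴ) = ρ' ∧
        ptrace1 (U * (ρ ⊗ₖ σ) * Uᴴ) = σ) :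
    vN ρ < vN ρ' ∧ ρ.rank ≤ ρ'.rank := by
  obtain ⟨m, σ, hσ, U, hU, h2, h1⟩ := h
  obtain ⟨V, hV, hVρ⟩ := exists_unitary_conj_eq_diagonal_eigs hρ.1.isHermitian
  obtain ⟨V', hV', hVρ'⟩ := exists_unitary_conj_eq_diagonal_eigs hρ'.1.isHermitian
  obtain ⟨W, hW, hWσ⟩ := exists_unitary_conj_eq_diagonal_eigs hσ.1.isHermitian
  have hVW : V ⊗ₖ W ∈ Matrix.unitaryGroup (Fin n × Fin m) ℂ :=
    Matrix.kronecker_mem_unitary hV hW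
  have hVW' : V' ⊗ₖ W ∈ Matrix.unitaryGroup (Fin n × Fin m) ℂ :=
    Matrix.kronecker_mem_unitary hV' hW
  set A : Matrix (Fin n × Fin m) (Fin n × Fin m) ℂ := (V' ⊗ₖ W)ᴴ * U * (V ⊗ₖ W) with hA_def
  have hA : A ∈ Matrix.unitaryGroup (Fin n × Fin m) ℂ :=
    mul_mem (mul_mem (Unitary.star_mem hVW') hU) hVW
  have hdiag : (V ⊗ₖ W)ᴴ * (ρ ⊗ₖ σ) * (V ⊗ₖ W) =
      Matrix.diagonal fun y => ((eigs ρ y.1 * eigs σ y.2 : ℝ) : ℂ) := by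
    rw [Matrix.conjTranspose_kronecker, ← Matrix.mul_kronecker_mul, ← Matrix.mul_kronecker_mul,
      hVρ, hWσ, Matrix.diagonal_kronecker_diagonal]
    simp
  have hVV : (V ⊗ₖ W) * (V ⊗ₖ W)ᴴ = 1 := Matrix.mem_unitaryGroup_iff.1 hVW
  have hτ : (V' ⊗ₖ W)ᴴ * (U * (ρ ⊗ₖ σ) * Uᴴ) * (V' ⊗ₖ W) =
      A * (Matrix.diagonal fun y => ((eigs ρ y.1 * eigs σ y.2 : ℝ) : ℂ)) * Aᴴ := by
    rw [← hdiag]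
    calc (V' ⊗ₖ W)ᴴ * (U * (ρ ⊗ₖ σ) * Uᴴ) * (V' ⊗ₖ W)
        = (V' ⊗ₖ W)ᴴ * U * ((V ⊗ₖ W) * (V ⊗ₖ W)ᴴ) * (ρ ⊗ₖ σ) *
            ((V ⊗ₖ W) * (V ⊗ₖ W)ᴴ) * Uᴴ * (V' ⊗ₖ W) := by
          simp only [hVV, mul_one, mul_assoc]
      _ = _ := by
          simp only [hA_def, Matrix.conjTranspose_mul, Matrix.conjTranspose_conjTranspose,
            mul_assoc]
  have hfst := ptrace2_kronecker_conj V' hW (U * (ρ ⊗ₖ σ) * Uᴴ)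
  rw [h2, hVρ', hτ] at hfst
  have hsnd := ptrace1_kronecker_conj hV' W (U * (ρ ⊗ₖ σ) * Uᴴ)
  rw [h1, hWσ, hτ] at hsnd
  rw [rank_eq_card_eigs_ne_zero hρ.1.isHermitian, rank_eq_card_eigs_ne_zero hρ'.1.isHermitian]
  refine catalytic_of_doublyStochastic (B := fun x y => Complex.normSq (A x y))
    (fun x y => Complex.normSq_nonneg _) (sum_normSq_row hA) (sum_normSq_col hA)
    hρ.eigs_nonneg hρ'.eigs_nonneg hσ.eigs_nonneg hρ.sum_eigs hρ'.sum_eigs hσ.sum_eigs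
    (fun i => ?_) (fun j => ?_) hspec
  · have h := congrFun (congrFun hfst i) i
    simp only [ptrace2, Matrix.of_apply, conj_diagonal_apply_self, Matrix.diagonal_apply_eq] at h
    exact_mod_cast h
  · have h := congrFun (congrFun hsnd j) j
    simp only [ptrace1, Matrix.of_apply, conj_diagonal_apply_self, Matrix.diagonal_apply_eq] at h
    exact_mod_cast h
end
end
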